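/- Let P be a heptagonal typical 7-configuration with points p₀,…,p₆ numbered consecutively along the cyclic order coming from convex position (indices modulo 7). Then for every i and every j with j ∉ {i, i+1}, one has d_{i,j} + d_{i+1,j} = 1. -/

import Mathlib

open scoped LinearAlgebra.Projectivization
open Projectivization

noncomputable section

/-- The real projective plane: the projectivization of `ℝ³`. -/
abbrev RP2 := ℙ ℝ (Fin 3 → ℝ)

/-- The quotient topology on the real projective plane. -/
instance : TopologicalSpace RP2 :=
  inferInstanceAs (TopologicalSpace (Quotient (projectivizationSetoid ℝ (Fin 3 → ℝ))))

/-- Three points of `ℙ²(ℝ)` are collinear if they admit linearly dependent representatives. -/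
def Collin (a b c : RP2) : Prop :=
  ¬ LinearIndependent ℝ ![a.rep, b.rep, c.rep]

/-- The conic (zero set in `ℙ²(ℝ)`) associated to a quadratic form on `ℝ³`. -/
def ConicSet (q : QuadraticForm ℝ (Fin 3 → ℝ)) : Set RP2 := {p : RP2 | q p.rep = 0}

/-- A set of points is coconic if some conic contains all of them. -/
def Coconic (s : Set RP2) : Prop :=
  ∃ q : QuadraticForm ℝ (Fin 3 → ℝ), q ≠ 0 ∧ ∀ p ∈ s, q p.rep = 0

/-- A labeled `n`-configuration is simple if it is injective and has no collinear triple. -/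
def SimpleCfg {n : ℕ} (f : Fin n → RP2) : Prop :=
  Function.Injective f ∧
    ∀ i j k : Fin n, i ≠ j → i ≠ k → j ≠ k → ¬ Collin (f i) (f j) (f k)

/-- A labeled `n`-configuration is typical if it is simple and no six of its points are coconic. -/
def TypicalCfg {n : ℕ} (f : Fin n → RP2) : Prop :=
  SimpleCfg f ∧ ∀ g : Fin 6 → Fin n, Function.Injective g → ¬ Coconic (Set.range (f ∘ g))

/-- A projective line: the set of points whose representatives lie in a 2-dimensional
subspace of `ℝ³`. -/
def IsProjLine (L : Set RP2) : Prop :=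
  ∃ W : Submodule ℝ (Fin 3 → ℝ), Module.finrank ℝ W = 2 ∧ L = {p : RP2 | p.rep ∈ W}

/-- `p` lies inside the conic of `q` if every projective line through `p` meets the conic. -/
def InsideConic (q : QuadraticForm ℝ (Fin 3 → ℝ)) (p : RP2) : Prop :=
  ∀ L : Set RP2, IsProjLine L → p ∈ L → (L ∩ ConicSet q).Nonempty

/-- `p` lies outside the conic of `q` if some projective line through `p` misses the conic. -/
def OutsideConic (q : QuadraticForm ℝ (Fin 3 → ℝ)) (p : RP2) : Prop :=
  ∃ L : Set RP2, IsProjLine L ∧ p ∈ L ∧ L ∩ ConicSet q = ∅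

/-- A point `f i` of a configuration is dominant if it lies outside every conic passing
through all the other points of the configuration. -/
def Dominant {n : ℕ} (f : Fin n → RP2) (i : Fin n) : Prop :=
  ∀ q : QuadraticForm ℝ (Fin 3 → ℝ), q ≠ 0 → (∀ j, j ≠ i → q ((f j).rep) = 0) →
    OutsideConic q (f i)

/-- A point `f i` of a configuration is subdominant if it lies inside every conic passing
through all the other points of the configuration. -/
def Subdominant {n : ℕ} (f : Fin n → RP2) (i : Fin n) : Prop :=
  ∀ q : QuadraticForm ℝ (Fin 3 → ℝ), q ≠ 0 → (∀ j, j ≠ i → q ((f j).rep) = 0) →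
    InsideConic q (f i)

/-- The affine chart determined by a nonzero linear functional `φ` (with `L∞ = {φ = 0}`):
a point off `L∞` is sent to its representative rescaled to lie on the affine plane `φ = 1`. -/
def chart (φ : (Fin 3 → ℝ) →ₗ[ℝ] ℝ) (p : RP2) : Fin 3 → ℝ := (φ p.rep)⁻¹ • p.rep

/-- Convex position with respect to the affine chart of `φ`: the line `{φ = 0}` misses the
configuration, and in the chart every point lies outside the convex hull of the others. -/
def ConvexPosWith {n : ℕ} (φ : (Fin 3 → ℝ) →ₗ[ℝ] ℝ) (f : Fin n → RP2) : Prop :=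
  φ ≠ 0 ∧ (∀ i, φ (f i).rep ≠ 0) ∧
    ∀ i, chart φ (f i) ∉ convexHull ℝ (chart φ '' (f '' {j | j ≠ i}))

/-- A configuration is in convex position if it is so in some affine chart. -/
def ConvexPos {n : ℕ} (f : Fin n → RP2) : Prop := ∃ φ, ConvexPosWith φ f

/-- The labeling of a configuration is consecutive for the convex position in the chart of `φ`:
each pair `f i`, `f (i+1)` (cyclically) spans an edge of the convex polygon, i.e. is cut out by
an affine functional which is strictly larger on both of them than on all the other points. -/
def ConsecWith {n : ℕ} [NeZero n] (φ : (Fin 3 → ℝ) →ₗ[ℝ] ℝ) (f : Fin n → RP2) : Prop :=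
  ConvexPosWith φ f ∧
    ∀ i : Fin n, ∃ ψ : (Fin 3 → ℝ) →ₗ[ℝ] ℝ,
      ψ (chart φ (f i)) = ψ (chart φ (f (i + 1))) ∧
      ∀ j : Fin n, j ≠ i → j ≠ i + 1 → ψ (chart φ (f j)) < ψ (chart φ (f i))

/-- A configuration is in convex position with consecutive cyclic labeling. -/
def ConsecConvexPos {n : ℕ} [NeZero n] (f : Fin n → RP2) : Prop := ∃ φ, ConsecWith φ f

/-- A Q-deformation (an `n`-tuple of continuous paths through typical configurations). -/
def QDeformFam (n : ℕ) (γ : Fin n → unitInterval → RP2) : Prop :=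
  (∀ i, Continuous (γ i)) ∧ ∀ t : unitInterval, TypicalCfg (fun i => γ i t)

end
noncomputable section

/-- `f i` lies outside every conic through the five points of the 7-configuration other
than `f i` and `f j`. -/
def OutAll (f : Fin 7 → RP2) (i j : Fin 7) : Prop :=
  ∀ q : QuadraticForm ℝ (Fin 3 → ℝ), q ≠ 0 → (∀ k, k ≠ i → k ≠ j → q ((f k).rep) = 0) →
    OutsideConic q (f i)

open Classical in
/-- `d_{i,j}` equals 1 if `f i` lies outside every conic through the five remaining points,
and 0 otherwise (i.e. if it lies inside every such conic). -/
def dIdx (f : Fin 7 → RP2) (i j : Fin 7) : ℕ :=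
  if OutAll f i j then 1 else 0

/-- The dominance index `d(p_i) = Σ_{j ≠ i} d_{i,j}`. -/
def domIdx (f : Fin 7 → RP2) (i : Fin 7) : ℕ :=
  ∑ j ∈ Finset.univ.erase i, dIdx f i j

section QuadraticForms

variable {V : Type*} [AddCommGroup V] [Module ℝ V]

lemma QuadraticForm.apply_eq_zero_iff_of_smul (q : QuadraticForm ℝ V) {c : ℝ} (hc : c ≠ 0)
    {v w : V} (h : w = c • v) : q w = 0 ↔ q v = 0 := by
  rw [h, QuadraticMap.map_smul]
  simp [hc]

lemma QuadraticForm.map_smul_add_smul (q : QuadraticForm ℝ V) (s t : ℝ) (u v : V) :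
    q (s • u + t • v) = s * s * q u + t * t * q v + s * t * QuadraticMap.polar q u v := by
  rw [QuadraticMap.map_add (f := q), QuadraticMap.map_smul, QuadraticMap.map_smul,
    QuadraticMap.polar_smul_left, QuadraticMap.polar_smul_right]
  simp only [smul_eq_mul]
  ring

/-- Coordinate formula for a quadratic form vanishing on the vectors of a basis. -/
lemma QuadraticForm.apply_of_vanish_basis (q : QuadraticForm ℝ V) (b : Module.Basis (Fin 3) ℝ V)
    (hq : ∀ i, q (b i) = 0) (x : V) :
    q x = QuadraticMap.polar q (b 1) (b 2) * (b.repr x 1 * b.repr x 2)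
      + QuadraticMap.polar q (b 0) (b 2) * (b.repr x 0 * b.repr x 2)
      + QuadraticMap.polar q (b 0) (b 1) * (b.repr x 0 * b.repr x 1) := by
  conv_lhs => rw [← b.sum_repr x, Fin.sum_univ_three]
  simp only [QuadraticMap.map_add (f := q), QuadraticMap.map_smul, QuadraticMap.polar_add_left,
    QuadraticMap.polar_smul_left, QuadraticMap.polar_smul_right, hq, smul_eq_mul]
  ring

end QuadraticForms

lemma apply_rep_mk_eq_zero_iff (q : QuadraticForm ℝ (Fin 3 → ℝ)) (v : Fin 3 → ℝ) (hv : v ≠ 0) :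
    q (Projectivization.mk ℝ v hv).rep = 0 ↔ q v = 0 := by
  obtain ⟨c, hc⟩ := Projectivization.exists_smul_eq_mk_rep ℝ v hv
  exact q.apply_eq_zero_iff_of_smul c.ne_zero hc.symm

/-- A point is outside a conic not through it iff the polar discriminant is somewhere positive. -/
lemma outsideConic_mk_iff (q : QuadraticForm ℝ (Fin 3 → ℝ)) (v : Fin 3 → ℝ) (hv : v ≠ 0)
    (hqv : q v ≠ 0) :
    OutsideConic q (Projectivization.mk ℝ v hv) ↔
      ∃ x, 0 < 4 * q x * q v - QuadraticMap.polar q x v ^ 2 := by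
  obtain ⟨c, hc⟩ := Projectivization.exists_smul_eq_mk_rep ℝ v hv
  have hmem (W : Submodule ℝ (Fin 3 → ℝ)) (w : Fin 3 → ℝ) (hw : w ≠ 0) :
      (Projectivization.mk ℝ w hw).rep ∈ W ↔ w ∈ W := by
    obtain ⟨d, hd⟩ := Projectivization.exists_smul_eq_mk_rep ℝ w hw
    rw [← hd]
    exact W.smul_mem_iff d.ne_zero
  constructor
  · rintro ⟨L, ⟨W, hW, rfl⟩, hp, hL⟩
    have hvW : v ∈ W := (hmem W v hv).1 hp
    have hne : ∀ w ∈ W, w ≠ 0 → q w ≠ 0 := by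
      intro w hwW hw hqw
      have : Projectivization.mk ℝ w hw ∈ {p : RP2 | p.rep ∈ W} ∩ ConicSet q :=
        ⟨(hmem W w hw).2 hwW, (apply_rep_mk_eq_zero_iff q w hw).2 hqw⟩
      rw [hL] at this
      exact this
    have hlt : ¬ W ≤ Submodule.span ℝ {v} := by
      intro hle
      have h1 := Submodule.finrank_mono hle
      rw [hW, finrank_span_singleton hv] at h1
      omega
    obtain ⟨w, hwW, hwv⟩ := SetLike.not_le_iff_exists.1 hlt
    refine ⟨w, ?_⟩
    by_contra! hneg
    have hroot : ∃ t : ℝ, q v * (t * t) + QuadraticMap.polar q w v * t + q w = 0 := by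
      refine exists_quadratic_eq_zero hqv ⟨√(QuadraticMap.polar q w v ^ 2 - 4 * q w * q v), ?_⟩
      rw [Real.mul_self_sqrt (by linarith), discrim]
      ring
    obtain ⟨t, ht⟩ := hroot
    refine hne ((1 : ℝ) • w + t • v) (W.add_mem (W.smul_mem _ hwW) (W.smul_mem _ hvW)) ?_ ?_
    · intro h0
      apply hwv
      rw [Submodule.mem_span_singleton]
      refine ⟨-t, ?_⟩
      rw [neg_smul, eq_comm, eq_neg_iff_add_eq_zero]
      simpa using h0
    · rw [q.map_smul_add_smul]
      linarith
  · rintro ⟨x, hx⟩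
    have hindep : LinearIndependent ℝ ![v, x] := by
      rw [LinearIndependent.pair_iff' hv]
      rintro a rfl
      rw [QuadraticMap.map_smul, QuadraticMap.polar_smul_left, QuadraticMap.polar_self] at hx
      simp only [smul_eq_mul, nsmul_eq_mul, Nat.cast_ofNat] at hx
      linarith
    refine ⟨{p : RP2 | p.rep ∈ Submodule.span ℝ (Set.range ![v, x])},
      ⟨Submodule.span ℝ (Set.range ![v, x]), ?_, rfl⟩, ?_, ?_⟩
    · rw [finrank_span_eq_card hindep]
      simp
    · exact (hmem (Submodule.span ℝ (Set.range ![v, x])) v hv).2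
        (Submodule.subset_span (Set.mem_range_self (0 : Fin 2)))
    · rw [Set.eq_empty_iff_forall_notMem]
      rintro r ⟨hr, hqr⟩
      simp only [Set.mem_ofPred_eq, Matrix.range_cons, Matrix.range_empty, Set.union_empty,
        Set.singleton_union] at hr
      obtain ⟨s, t, hst⟩ := Submodule.mem_span_pair.1 hr
      have hqr' : q r.rep = 0 := hqr
      rw [← hst, q.map_smul_add_smul, QuadraticMap.polar_comm] at hqr'
      have ht : t = 0 := by
        by_contra ht
        have ht2 : 0 < t ^ 2 := by positivity
        have key : (2 * s * q v + t * QuadraticMap.polar q x v) ^ 2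
            + t ^ 2 * (4 * q x * q v - QuadraticMap.polar q x v ^ 2) = 0 := by
          linear_combination 4 * q v * hqr'
        nlinarith [mul_pos ht2 hx, sq_nonneg (2 * s * q v + t * QuadraticMap.polar q x v)]
      have hs : s = 0 := by
        subst ht
        simpa [hqv] using hqr'
      exact r.rep_nonzero (by rw [← hst, hs, ht]; simp)

/-- For the ternary form `a x₂x₃ + b x₁x₃ + c x₁x₂`, the polar discriminant at `p` takes a
positive value exactly when the form at `p` has sign opposite to its determinant. -/
lemma exists_polarDiscr_pos_iff {a b c p₁ p₂ p₃ : ℝ} (hp : p₁ ≠ 0)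
    (h : a * b * c * (a * (p₂ * p₃) + b * (p₁ * p₃) + c * (p₁ * p₂)) ≠ 0) :
    (∃ x₁ x₂ x₃ : ℝ,
      0 < 4 * (a * (x₂ * x₃) + b * (x₁ * x₃) + c * (x₁ * x₂))
            * (a * (p₂ * p₃) + b * (p₁ * p₃) + c * (p₁ * p₂))
          - (a * (x₂ * p₃ + x₃ * p₂) + b * (x₁ * p₃ + x₃ * p₁) + c * (x₁ * p₂ + x₂ * p₁)) ^ 2) ↔
      a * b * c * (a * (p₂ * p₃) + b * (p₁ * p₃) + c * (p₁ * p₂)) < 0 := by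
  obtain ⟨Q, hQ⟩ : ∃ Q, Q = a * (p₂ * p₃) + b * (p₁ * p₃) + c * (p₁ * p₂) := ⟨_, rfl⟩
  obtain ⟨U, hU⟩ : ∃ U, U = c * p₁ + a * p₃ := ⟨_, rfl⟩
  obtain ⟨W, hW⟩ : ∃ W, W = b * p₁ + a * p₂ := ⟨_, rfl⟩
  have hUW : U * W = b * c * p₁ ^ 2 + a * Q := by rw [hU, hW, hQ]; ring
  have hp2 : 0 < p₁ ^ 2 := by positivity
  rw [← hQ] at h ⊢
  constructor
  · rintro ⟨x₁, x₂, x₃, hx⟩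
    by_contra! hneg
    have hpos : 0 < a * b * c * Q := lt_of_le_of_ne hneg h.symm
    obtain ⟨s, hs⟩ : ∃ s, s = p₁ * x₂ - x₁ * p₂ := ⟨_, rfl⟩
    obtain ⟨t, ht⟩ : ∃ t, t = p₁ * x₃ - x₁ * p₃ := ⟨_, rfl⟩
    have h1 : 0 < 4 * s * t * a * Q - (s * U + t * W) ^ 2 := by
      have := mul_pos hp2 hx
      have e : p₁ ^ 2 * (4 * (a * (x₂ * x₃) + b * (x₁ * x₃) + c * (x₁ * x₂)) * Q
          - (a * (x₂ * p₃ + x₃ * p₂) + b * (x₁ * p₃ + x₃ * p₁) + c * (x₁ * p₂ + x₂ * p₁)) ^ 2)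
          = 4 * s * t * a * Q - (s * U + t * W) ^ 2 := by
        rw [hs, ht, hU, hW, hQ]; ring
      rwa [e] at this
    have hUne : U ≠ 0 := by
      rintro h0
      rw [h0] at hUW
      have : a * b * c * Q = - (b * c * p₁) ^ 2 := by linear_combination (-b * c) * hUW
      nlinarith [sq_nonneg (b * c * p₁)]
    have hU2 : 0 < U ^ 2 := by positivity
    have h2 := mul_pos hU2 h1
    have e : U ^ 2 * (4 * s * t * a * Q - (s * U + t * W) ^ 2)
        = -(U ^ 2 * s - (2 * a * Q - U * W) * t) ^ 2 - 4 * (a * b * c * Q) * (p₁ * t) ^ 2 := by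
      linear_combination (-4 * a * Q * t ^ 2) * hUW
    nlinarith [sq_nonneg (U ^ 2 * s - (2 * a * Q - U * W) * t),
      mul_nonneg hpos.le (sq_nonneg (p₁ * t))]
  · intro hneg
    have key : ∃ s t : ℝ, 0 < 4 * s * t * a * Q - (s * U + t * W) ^ 2 := by
      have haQ : a * Q ≠ 0 := by
        intro h0
        exact h (by linear_combination b * c * h0)
      have hval (k : ℝ) : 4 * (k / (4 * (a * Q))) * (a * Q) = k := by
        rw [mul_right_comm]
        exact mul_div_cancel₀ _ (mul_ne_zero four_ne_zero haQ)
      by_cases hU0 : U = 0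
      · refine ⟨(W ^ 2 + 1) / (4 * (a * Q)), 1, ?_⟩
        rw [hU0]
        linarith [hval (W ^ 2 + 1)]
      by_cases hW0 : W = 0
      · refine ⟨1, (U ^ 2 + 1) / (4 * (a * Q)), ?_⟩
        rw [hW0]
        linarith [hval (U ^ 2 + 1)]
      by_cases h1 : U * W * (a * Q) < 0
      · exact ⟨W, -U, by nlinarith⟩
      refine ⟨W, U, ?_⟩
      have h2 : U * W * (b * c) < 0 := by
        by_contra! h3
        have h4 := mul_nonneg (not_lt.1 h1) h3
        have h5 : 0 < (U * W) ^ 2 := by positivity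
        nlinarith [mul_pos h5 (neg_pos.2 hneg)]
      have e : 4 * W * U * a * Q - (W * U + U * W) ^ 2 = -4 * (U * W * (b * c)) * p₁ ^ 2 := by
        linear_combination (-4 * U * W) * hUW
      rw [e]
      nlinarith [mul_pos (neg_pos.2 h2) hp2]
    obtain ⟨s, t, hst⟩ := key
    refine ⟨0, s, t, ?_⟩
    convert hst using 1
    rw [hU, hW]
    ring

/-- Position of a point relative to a conic circumscribed about a basis. -/
lemma outsideConic_mk_iff_of_vanish_basis (q : QuadraticForm ℝ (Fin 3 → ℝ))
    (b : Module.Basis (Fin 3) ℝ (Fin 3 → ℝ)) (hq : ∀ i, q (b i) = 0) (v : Fin 3 → ℝ) (hv : v ≠ 0)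
    (hv0 : b.repr v 0 ≠ 0)
    (h : QuadraticMap.polar q (b 1) (b 2) * QuadraticMap.polar q (b 0) (b 2)
      * QuadraticMap.polar q (b 0) (b 1) * q v ≠ 0) :
    OutsideConic q (Projectivization.mk ℝ v hv) ↔
      QuadraticMap.polar q (b 1) (b 2) * QuadraticMap.polar q (b 0) (b 2)
        * QuadraticMap.polar q (b 0) (b 1) * q v < 0 := by
  rw [outsideConic_mk_iff q v hv (right_ne_zero_of_mul h)]
  rw [q.apply_of_vanish_basis b hq v] at h ⊢
  rw [← exists_polarDiscr_pos_iff hv0 h]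
  have hpolar (x : Fin 3 → ℝ) : QuadraticMap.polar q x v
      = QuadraticMap.polar q (b 1) (b 2)
          * (b.repr x 1 * b.repr v 2 + b.repr x 2 * b.repr v 1)
        + QuadraticMap.polar q (b 0) (b 2)
          * (b.repr x 0 * b.repr v 2 + b.repr x 2 * b.repr v 0)
        + QuadraticMap.polar q (b 0) (b 1)
          * (b.repr x 0 * b.repr v 1 + b.repr x 1 * b.repr v 0) := by
    rw [QuadraticMap.polar, q.apply_of_vanish_basis b hq (x + v), q.apply_of_vanish_basis b hq x,
      q.apply_of_vanish_basis b hq v]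
    simp only [map_add, Finsupp.add_apply]
    ring
  constructor
  · rintro ⟨x, hx⟩
    rw [hpolar, q.apply_of_vanish_basis b hq x] at hx
    exact ⟨_, _, _, hx⟩
  · rintro ⟨x₁, x₂, x₃, hx⟩
    refine ⟨b.equivFun.symm ![x₁, x₂, x₃], ?_⟩
    have hr (i : Fin 3) : b.repr (b.equivFun.symm ![x₁, x₂, x₃]) i = ![x₁, x₂, x₃] i := by
      rw [← b.equivFun_apply, LinearEquiv.apply_symm_apply]
    rw [hpolar, q.apply_of_vanish_basis b hq (b.equivFun.symm _), hr, hr, hr]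
    exact hx

/-- The quadratic form `a x₂x₃ + b x₁x₃ + c x₁x₂` in the coordinates of a basis. -/
def circumForm (b : Module.Basis (Fin 3) ℝ (Fin 3 → ℝ)) (k₀ k₁ k₂ : ℝ) :
    QuadraticForm ℝ (Fin 3 → ℝ) :=
  k₀ • QuadraticMap.linMulLin (b.coord 1) (b.coord 2)
    + k₁ • QuadraticMap.linMulLin (b.coord 0) (b.coord 2)
    + k₂ • QuadraticMap.linMulLin (b.coord 0) (b.coord 1)

lemma circumForm_apply (b : Module.Basis (Fin 3) ℝ (Fin 3 → ℝ)) (k₀ k₁ k₂ : ℝ) (x : Fin 3 → ℝ) :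
    circumForm b k₀ k₁ k₂ x = k₀ * (b.repr x 1 * b.repr x 2) + k₁ * (b.repr x 0 * b.repr x 2)
      + k₂ * (b.repr x 0 * b.repr x 1) := by
  simp [circumForm]

lemma circumForm_basis (b : Module.Basis (Fin 3) ℝ (Fin 3 → ℝ)) (k₀ k₁ k₂ : ℝ) (i : Fin 3) :
    circumForm b k₀ k₁ k₂ (b i) = 0 := by
  rw [circumForm_apply]
  fin_cases i <;> simp

lemma circumForm_ne_zero (b : Module.Basis (Fin 3) ℝ (Fin 3 → ℝ)) {k₀ k₁ k₂ : ℝ} (hk : k₀ ≠ 0) :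
    circumForm b k₀ k₁ k₂ ≠ 0 := by
  intro h
  have h1 := circumForm_apply b k₀ k₁ k₂ (b 1 + b 2)
  rw [h] at h1
  simp at h1
  exact hk h1.symm

/-- The coordinate signs of a point `y` such that the basis vectors, `c` and `y` are, in this order,
the vertices of a convex pentagon. -/
def FollowsBasis (b : Module.Basis (Fin 3) ℝ (Fin 3 → ℝ)) (c y : Fin 3 → ℝ) : Prop :=
  0 < b.repr y 0 ∧ b.repr y 1 < 0 ∧ 0 < b.repr y 2 ∧
  0 < b.repr c 1 * b.repr y 2 - b.repr c 2 * b.repr y 1 ∧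
  0 < b.repr c 2 * b.repr y 0 - b.repr c 0 * b.repr y 2 ∧
  0 < b.repr c 0 * b.repr y 1 - b.repr c 1 * b.repr y 0

/-- The conic through the basis vectors and `c`, `y`. -/
def fiveForm (b : Module.Basis (Fin 3) ℝ (Fin 3 → ℝ)) (c y : Fin 3 → ℝ) :
    QuadraticForm ℝ (Fin 3 → ℝ) :=
  circumForm b (b.repr c 0 * b.repr y 0 * (b.repr c 2 * b.repr y 1 - b.repr c 1 * b.repr y 2))
    (b.repr c 1 * b.repr y 1 * (b.repr c 0 * b.repr y 2 - b.repr c 2 * b.repr y 0))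
    (b.repr c 2 * b.repr y 2 * (b.repr c 1 * b.repr y 0 - b.repr c 0 * b.repr y 1))

lemma fiveForm_left (b : Module.Basis (Fin 3) ℝ (Fin 3 → ℝ)) (c y : Fin 3 → ℝ) :
    fiveForm b c y c = 0 := by
  rw [fiveForm, circumForm_apply]; ring

lemma fiveForm_right (b : Module.Basis (Fin 3) ℝ (Fin 3 → ℝ)) (c y : Fin 3 → ℝ) :
    fiveForm b c y y = 0 := by
  rw [fiveForm, circumForm_apply]; ring

lemma fiveForm_swap (b : Module.Basis (Fin 3) ℝ (Fin 3 → ℝ)) (c y z : Fin 3 → ℝ) :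
    fiveForm b c z y = - fiveForm b c y z := by
  rw [fiveForm, fiveForm, circumForm_apply, circumForm_apply]; ring

lemma fiveForm_ne_zero (b : Module.Basis (Fin 3) ℝ (Fin 3 → ℝ)) {c y : Fin 3 → ℝ}
    (hc : 0 < b.repr c 0) (hy : FollowsBasis b c y) : fiveForm b c y ≠ 0 := by
  obtain ⟨hy0, -, -, h, -, -⟩ := hy
  exact circumForm_ne_zero b (mul_ne_zero (mul_pos hc hy0).ne' (by linarith))

/-- A conic through five convex vertices has `z` outside iff the explicit form is positive. -/
lemma outsideConic_iff_fiveForm_pos (b : Module.Basis (Fin 3) ℝ (Fin 3 → ℝ)) {c y z : Fin 3 → ℝ}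
    (hc0 : 0 < b.repr c 0) (hc1 : b.repr c 1 < 0) (hc2 : 0 < b.repr c 2)
    (hy : FollowsBasis b c y) (hz : z ≠ 0) (hz0 : b.repr z 0 ≠ 0) (hyz : fiveForm b c y z ≠ 0)
    (q : QuadraticForm ℝ (Fin 3 → ℝ)) (hq : q ≠ 0) (hqb : ∀ i, q (b i) = 0) (hqc : q c = 0)
    (hqy : q y = 0) :
    OutsideConic q (Projectivization.mk ℝ z hz) ↔ 0 < fiveForm b c y z := by
  obtain ⟨hy0, hy1, hy2, h0, h1, h2⟩ := hy
  have hqx := q.apply_of_vanish_basis b hqb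
  rw [hqx] at hqc hqy
  have hout := outsideConic_mk_iff_of_vanish_basis q b hqb z hz hz0
  rw [hqx z] at hout
  rw [fiveForm, circumForm_apply] at hyz ⊢
  have hk0 : b.repr c 0 * b.repr y 0 * (b.repr c 2 * b.repr y 1 - b.repr c 1 * b.repr y 2) < 0 :=
    mul_neg_of_pos_of_neg (mul_pos hc0 hy0) (by linarith)
  have hk1 : b.repr c 1 * b.repr y 1 * (b.repr c 0 * b.repr y 2 - b.repr c 2 * b.repr y 0) < 0 :=
    mul_neg_of_pos_of_neg (mul_pos_of_neg_of_neg hc1 hy1) (by linarith)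
  have hk2 : b.repr c 2 * b.repr y 2 * (b.repr c 1 * b.repr y 0 - b.repr c 0 * b.repr y 1) < 0 :=
    mul_neg_of_pos_of_neg (mul_pos hc2 hy2) (by linarith)
  generalize QuadraticMap.polar q (b 1) (b 2) = A₀ at *
  generalize QuadraticMap.polar q (b 0) (b 2) = A₁ at *
  generalize QuadraticMap.polar q (b 0) (b 1) = A₂ at *
  have e1 : A₀ * (b.repr c 1 * b.repr y 1 * (b.repr c 0 * b.repr y 2 - b.repr c 2 * b.repr y 0))
      = A₁ * (b.repr c 0 * b.repr y 0 * (b.repr c 2 * b.repr y 1 - b.repr c 1 * b.repr y 2)) := by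
    linear_combination b.repr c 0 * b.repr c 1 * hqy - b.repr y 0 * b.repr y 1 * hqc
  have e2 : A₀ * (b.repr c 2 * b.repr y 2 * (b.repr c 1 * b.repr y 0 - b.repr c 0 * b.repr y 1))
      = A₂ * (b.repr c 0 * b.repr y 0 * (b.repr c 2 * b.repr y 1 - b.repr c 1 * b.repr y 2)) := by
    linear_combination b.repr y 0 * b.repr y 2 * hqc - b.repr c 0 * b.repr c 2 * hqy
  generalize b.repr c 0 * b.repr y 0 * (b.repr c 2 * b.repr y 1 - b.repr c 1 * b.repr y 2) = k₀ at *
  generalize b.repr c 1 * b.repr y 1 * (b.repr c 0 * b.repr y 2 - b.repr c 2 * b.repr y 0) = k₁ at *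
  generalize b.repr c 2 * b.repr y 2 * (b.repr c 1 * b.repr y 0 - b.repr c 0 * b.repr y 1) = k₂ at *
  obtain ⟨t, rfl⟩ : ∃ t, A₀ = t * k₀ := ⟨A₀ / k₀, by field_simp [hk0.ne]⟩
  obtain rfl : A₁ = t * k₁ := mul_right_cancel₀ hk0.ne (by linear_combination -e1)
  obtain rfl : A₂ = t * k₂ := mul_right_cancel₀ hk0.ne (by linear_combination -e2)
  have ht : t ≠ 0 := by
    rintro rfl
    exact hq (QuadraticMap.ext fun x => by rw [hqx x]; simp)
  have ht4 : 0 < t ^ 4 := by positivity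
  have hk : 0 < t ^ 4 * (k₀ * k₁ * -k₂) :=
    mul_pos ht4 (mul_pos (mul_pos_of_neg_of_neg hk0 hk1) (neg_pos.2 hk2))
  obtain ⟨F, hF⟩ : ∃ F, F = k₀ * (b.repr z 1 * b.repr z 2) + k₁ * (b.repr z 0 * b.repr z 2)
      + k₂ * (b.repr z 0 * b.repr z 1) := ⟨_, rfl⟩
  have e : t * k₀ * (t * k₁) * (t * k₂) * (t * k₀ * (b.repr z 1 * b.repr z 2)
      + t * k₁ * (b.repr z 0 * b.repr z 2) + t * k₂ * (b.repr z 0 * b.repr z 1))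
      = -((t ^ 4 * (k₀ * k₁ * -k₂)) * F) := by rw [hF]; ring
  rw [← hF] at hyz ⊢
  rw [e] at hout
  rw [hout (neg_ne_zero.2 (mul_ne_zero hk.ne' hyz)), neg_lt_zero, mul_pos_iff_of_pos_left hk]

/-- All conics through the basis points, `c` and `y` have `z` outside. -/
def OutFive (b : Module.Basis (Fin 3) ℝ (Fin 3 → ℝ)) (c y : Fin 3 → ℝ) (p : RP2) : Prop :=
  ∀ q : QuadraticForm ℝ (Fin 3 → ℝ), q ≠ 0 → (∀ i, q (b i) = 0) → q c = 0 → q y = 0 →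
    OutsideConic q p

lemma outFive_iff (b : Module.Basis (Fin 3) ℝ (Fin 3 → ℝ)) {c y z : Fin 3 → ℝ}
    (hc0 : 0 < b.repr c 0) (hc1 : b.repr c 1 < 0) (hc2 : 0 < b.repr c 2)
    (hy : FollowsBasis b c y) (hz : z ≠ 0) (hz0 : b.repr z 0 ≠ 0) (hyz : fiveForm b c y z ≠ 0) :
    OutFive b c y (Projectivization.mk ℝ z hz) ↔ 0 < fiveForm b c y z := by
  have key := outsideConic_iff_fiveForm_pos b hc0 hc1 hc2 hy hz hz0 hyz
  constructor
  · intro h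
    have hb := circumForm_basis b
      (b.repr c 0 * b.repr y 0 * (b.repr c 2 * b.repr y 1 - b.repr c 1 * b.repr y 2))
      (b.repr c 1 * b.repr y 1 * (b.repr c 0 * b.repr y 2 - b.repr c 2 * b.repr y 0))
      (b.repr c 2 * b.repr y 2 * (b.repr c 1 * b.repr y 0 - b.repr c 0 * b.repr y 1))
    have hne := fiveForm_ne_zero b hc0 hy
    have hl := fiveForm_left b c y
    have hr := fiveForm_right b c y
    exact (key _ hne hb hl hr).1 (h _ hne hb hl hr)
  · intro h q hq hqb hqc hqy
    exact (key q hq hqb hqc hqy).2 h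

/-- For a convex hexagon with vertices not on a conic, exactly one of two adjacent vertices lies
outside the conic through the other five. -/
lemma outFive_iff_not_outFive (b : Module.Basis (Fin 3) ℝ (Fin 3 → ℝ)) {c y z : Fin 3 → ℝ}
    (hc0 : 0 < b.repr c 0) (hc1 : b.repr c 1 < 0) (hc2 : 0 < b.repr c 2)
    (hy : FollowsBasis b c y) (hz : FollowsBasis b c z) (hy' : y ≠ 0) (hz' : z ≠ 0)
    (hcon : ∀ q : QuadraticForm ℝ (Fin 3 → ℝ), q ≠ 0 → (∀ i, q (b i) = 0) → q c = 0 → q y = 0 →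
      q z ≠ 0) :
    OutFive b c y (Projectivization.mk ℝ z hz') ↔
      ¬ OutFive b c z (Projectivization.mk ℝ y hy') := by
  have hne : fiveForm b c y z ≠ 0 :=
    hcon _ (fiveForm_ne_zero b hc0 hy) (circumForm_basis b _ _ _) (fiveForm_left b c y)
      (fiveForm_right b c y)
  have hne' : fiveForm b c z y ≠ 0 := by
    rw [fiveForm_swap]
    exact neg_ne_zero.2 hne
  rw [outFive_iff b hc0 hc1 hc2 hy hz' hz.1.ne' hne, outFive_iff b hc0 hc1 hc2 hz hy' hy.1.ne' hne',
    fiveForm_swap b c y z, not_lt, neg_nonpos]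
  exact ⟨le_of_lt, fun h => lt_of_le_of_ne h hne.symm⟩

/-- The determinant of three vectors of `ℝ³`. -/
def det3 (u v w : Fin 3 → ℝ) : ℝ :=
  u 0 * v 1 * w 2 - u 0 * v 2 * w 1 - u 1 * v 0 * w 2 + u 1 * v 2 * w 0 + u 2 * v 0 * w 1
    - u 2 * v 1 * w 0

lemma det3_rotate (u v w : Fin 3 → ℝ) : det3 v w u = det3 u v w := by
  simp only [det3]; ring

lemma det3_neg (u v w : Fin 3 → ℝ) : det3 (-u) (-v) (-w) = -det3 u v w := by
  simp only [det3, Pi.neg_apply]; ring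

lemma det3_smul (r s t : ℝ) (u v w : Fin 3 → ℝ) :
    det3 (r • u) (s • v) (t • w) = r * s * t * det3 u v w := by
  simp only [det3, Pi.smul_apply, smul_eq_mul]; ring

lemma det3_plucker (a b c d e : Fin 3 → ℝ) :
    det3 a b c * det3 a d e - det3 a b d * det3 a c e + det3 a b e * det3 a c d = 0 := by
  simp only [det3]; ring

lemma linearIndependent_iff_det3_ne_zero (u v w : Fin 3 → ℝ) :
    LinearIndependent ℝ ![u, v, w] ↔ det3 u v w ≠ 0 := by
  have h := Matrix.linearIndependent_rows_iff_isUnit (K := ℝ) (A := Matrix.of ![u, v, w])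
  rw [Matrix.isUnit_iff_isUnit_det, isUnit_iff_ne_zero, Matrix.det_fin_three] at h
  exact h

/-- A functional vanishing on `u`, `v` is proportional to the determinant against `u`, `v`. -/
lemma apply_mul_det3 (l : (Fin 3 → ℝ) →ₗ[ℝ] ℝ) {u v : Fin 3 → ℝ} (hu : l u = 0) (hv : l v = 0)
    (w x : Fin 3 → ℝ) : l x * det3 u v w = l w * det3 u v x := by
  have h : det3 u v w • x = det3 x v w • u + det3 u x w • v + det3 u v x • w := by
    ext i
    fin_cases i <;> simp [det3] <;> ring
  have h' := congrArg l h
  simp only [map_add, map_smul, hu, hv, smul_eq_mul] at h'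
  linarith

/-- If every edge of a closed heptagon has all other vertices on its positive side, then all
cyclically ordered triples are positively oriented. -/
lemma det3_pos_of_edges {V : ℕ → Fin 3 → ℝ} (hper : ∀ n, V (n + 7) = V n)
    (hedge : ∀ n m, n + 1 < m → m < n + 7 → 0 < det3 (V n) (V (n + 1)) (V m))
    {a b c : ℕ} (hab : a < b) (hbc : b < c) (hca : c < a + 7) :
    0 < det3 (V a) (V b) (V c) := by
  rcases (Nat.succ_le_of_lt hab).eq_or_lt with rfl | hab'
  · exact hedge a c hbc hca
  induction c, Nat.succ_le_of_lt hbc using Nat.le_induction with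
  | base =>
    have h := hedge b (a + 7) (by omega) (by omega)
    rwa [hper, det3_rotate] at h
  | succ c hc ih =>
    have h1 := ih (by omega) (by omega)
    have h2 := hedge c (a + 7) (by omega) (by omega)
    rw [hper, det3_rotate] at h2
    have hb := hedge a b hab' (by omega)
    have hc := hedge a c (by omega) (by omega)
    have hd := hedge a (c + 1) (by omega) (by omega)
    have hp := det3_plucker (V a) (V (a + 1)) (V b) (V c) (V (c + 1))
    have : 0 < det3 (V a) (V (a + 1)) (V c) * det3 (V a) (V b) (V (c + 1)) := by
      linarith [mul_pos hb h2, mul_pos hd h1]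
    exact (mul_pos_iff_of_pos_left hc).1 this

lemma det3_basis (b : Module.Basis (Fin 3) ℝ (Fin 3 → ℝ)) (x y z : Fin 3 → ℝ) :
    det3 x y z = det3 (b 0) (b 1) (b 2) *
      det3 (fun i => b.repr x i) (fun i => b.repr y i) (fun i => b.repr z i) := by
  conv_lhs => rw [← b.sum_repr x, ← b.sum_repr y, ← b.sum_repr z]
  simp only [Fin.sum_univ_three, det3, Pi.add_apply, Pi.smul_apply, smul_eq_mul]
  ring

/-- The coordinate signs of a point after the three vectors of a positive basis. -/
lemma repr_signs (b : Module.Basis (Fin 3) ℝ (Fin 3 → ℝ)) (hb : 0 < det3 (b 0) (b 1) (b 2))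
    {x : Fin 3 → ℝ} (h0 : 0 < det3 (b 1) (b 2) x) (h1 : 0 < det3 (b 0) (b 2) x)
    (h2 : 0 < det3 (b 0) (b 1) x) : 0 < b.repr x 0 ∧ b.repr x 1 < 0 ∧ 0 < b.repr x 2 := by
  rw [det3_basis b, mul_pos_iff_of_pos_left hb] at h0 h1 h2
  simp [det3] at h0 h1 h2
  exact ⟨h0, h1, h2⟩

lemma followsBasis_of_det3_pos (b : Module.Basis (Fin 3) ℝ (Fin 3 → ℝ))
    (hb : 0 < det3 (b 0) (b 1) (b 2)) {c x : Fin 3 → ℝ} (h0 : 0 < det3 (b 1) (b 2) x)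
    (h1 : 0 < det3 (b 0) (b 2) x) (h2 : 0 < det3 (b 0) (b 1) x) (h3 : 0 < det3 (b 0) c x)
    (h4 : 0 < det3 (b 1) c x) (h5 : 0 < det3 (b 2) c x) : FollowsBasis b c x := by
  obtain ⟨s0, s1, s2⟩ := repr_signs b hb h0 h1 h2
  rw [det3_basis b, mul_pos_iff_of_pos_left hb] at h3 h4 h5
  simp [det3] at h3 h4 h5
  exact ⟨s0, s1, s2, by linarith, by linarith, by linarith⟩

/-- The residue of a natural number modulo `7`. -/
def residue7 (n : ℕ) : Fin 7 := Fin.ofNat 7 n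

lemma residue7_add_seven (n : ℕ) : residue7 (n + 7) = residue7 n := by
  apply Fin.ext
  simp [residue7]

lemma residue7_succ (n : ℕ) : residue7 (n + 1) = residue7 n + 1 := by
  apply Fin.ext
  simp [residue7, Fin.val_add]

lemma residue7_val_add_seven (i : Fin 7) : residue7 (i.val + 7) = i := by
  apply Fin.ext
  simp [residue7, Nat.mod_eq_of_lt i.isLt]

lemma residue7_ne {n m : ℕ} (h1 : n < m) (h2 : m < n + 7) : residue7 n ≠ residue7 m := by
  intro h
  have := congrArg Fin.val h
  simp only [residue7, Fin.val_ofNat] at this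
  omega

/-- Consecutive convex position yields positively oriented homogeneous coordinates. -/
lemma exists_positive_lift (f : Fin 7 → RP2) (hf : SimpleCfg f) (hconv : ConsecConvexPos f) :
    ∃ V : ℕ → Fin 3 → ℝ, (∀ n, ∃ c : ℝ, c ≠ 0 ∧ V n = c • (f (residue7 n)).rep) ∧
      ∀ a b c : ℕ, a < b → b < c → c < a + 7 → 0 < det3 (V a) (V b) (V c) := by
  obtain ⟨φ, ⟨-, hφ, -⟩, hψ⟩ := hconv
  obtain ⟨U, hU⟩ : ∃ U : ℕ → Fin 3 → ℝ, ∀ n, U n = chart φ (f (residue7 n)) := ⟨_, fun _ => rfl⟩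
  have hper (n : ℕ) : U (n + 7) = U n := by rw [hU, hU, residue7_add_seven]
  have hne0 {a b c : ℕ} (hab : a < b) (hbc : b < c) (hca : c < a + 7) :
      det3 (U a) (U b) (U c) ≠ 0 := by
    have h := not_not.1 (hf.2 _ _ _ (residue7_ne hab (by omega)) (residue7_ne (hab.trans hbc) hca)
      (residue7_ne hbc (by omega)))
    rw [linearIndependent_iff_det3_ne_zero] at h
    rw [hU, hU, hU, chart, chart, chart, det3_smul]
    exact mul_ne_zero (mul_ne_zero (mul_ne_zero (inv_ne_zero (hφ _)) (inv_ne_zero (hφ _)))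
      (inv_ne_zero (hφ _))) h
  have hsame {n m k : ℕ} (hm : n + 1 < m) (hm' : m < n + 7) (hk : n + 1 < k) (hk' : k < n + 7) :
      0 < det3 (U n) (U (n + 1)) (U m) * det3 (U n) (U (n + 1)) (U k) := by
    obtain ⟨ψ, he, hlt⟩ := hψ (residue7 n)
    have hφU (r : ℕ) : φ (U r) = 1 := by
      rw [hU, chart, map_smul, smul_eq_mul, inv_mul_cancel₀ (hφ _)]
    have he' : ψ (U n) = ψ (U (n + 1)) := by rw [hU, hU, residue7_succ]; exact he
    have hlt' {r : ℕ} (hr : n + 1 < r) (hr' : r < n + 7) : ψ (U r) < ψ (U n) := by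
      rw [hU, hU]
      refine hlt _ (residue7_ne (by omega) hr').symm ?_
      rw [← residue7_succ]
      exact (residue7_ne hr (by omega)).symm
    obtain ⟨l, hl⟩ : ∃ l : (Fin 3 → ℝ) →ₗ[ℝ] ℝ, ∀ r, l (U r) = ψ (U n) - ψ (U r) :=
      ⟨ψ (U n) • φ - ψ, fun r => by simp [hφU]⟩
    have h := apply_mul_det3 l (u := U n) (v := U (n + 1)) (by rw [hl]; ring)
      (by rw [hl, he']; ring) (U m) (U k)
    have hlm : 0 < l (U m) := by rw [hl]; linarith [hlt' hm hm']
    have hlk : 0 < l (U k) := by rw [hl]; linarith [hlt' hk hk']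
    have hk0 := hne0 (Nat.lt_succ_self n) hk hk'
    have h2 : 0 < det3 (U n) (U (n + 1)) (U k) ^ 2 := by positivity
    have h3 : 0 < l (U k) * (det3 (U n) (U (n + 1)) (U m) * det3 (U n) (U (n + 1)) (U k)) := by
      rw [← mul_assoc, h, mul_assoc, ← sq]
      exact mul_pos hlm h2
    exact (mul_pos_iff_of_pos_left hlk).1 h3
  have hstep (n : ℕ) : 0 < det3 (U 0) (U 1) (U 2) * det3 (U n) (U (n + 1)) (U (n + 2)) := by
    induction n with
    | zero =>
      have := hne0 (a := 0) (b := 1) (c := 2) (by omega) (by omega) (by omega)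
      exact mul_self_pos.2 this
    | succ n ih =>
      have h := hsame (n := n + 1) (m := n + 7) (k := n + 3) (by omega) (by omega) (by omega)
        (by omega)
      rw [hper, det3_rotate] at h
      have hn := hne0 (a := n) (b := n + 1) (c := n + 2) (by omega) (by omega) (by omega)
      have h2 : 0 < det3 (U n) (U (n + 1)) (U (n + 2)) ^ 2 := by positivity
      have h3 := mul_pos ih h
      refine (mul_pos_iff_of_pos_left h2).1 (lt_of_lt_of_eq h3 ?_)
      ring_nf
  have hall {n m : ℕ} (hm : n + 1 < m) (hm' : m < n + 7) :
      0 < det3 (U 0) (U 1) (U 2) * det3 (U n) (U (n + 1)) (U m) := by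
    have hn := hne0 (a := n) (b := n + 1) (c := n + 2) (by omega) (by omega) (by omega)
    have h2 : 0 < det3 (U n) (U (n + 1)) (U (n + 2)) ^ 2 := by positivity
    have h3 := mul_pos (hstep n) (hsame (n := n) (m := n + 2) (k := m) (by omega) (by omega) hm hm')
    refine (mul_pos_iff_of_pos_left h2).1 (lt_of_lt_of_eq h3 ?_)
    ring
  have hrep (n : ℕ) : U n = (φ (f (residue7 n)).rep)⁻¹ • (f (residue7 n)).rep := hU n
  rcases lt_or_gt_of_ne (hne0 (a := 0) (b := 1) (c := 2) (by omega) (by omega) (by omega))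
    with h0 | h0
  · refine ⟨fun n => -U n, fun n => ⟨-(φ (f (residue7 n)).rep)⁻¹,
      neg_ne_zero.2 (inv_ne_zero (hφ _)), by rw [neg_smul, ← hrep]⟩, fun a b c hab hbc hca =>
      det3_pos_of_edges (V := fun n => -U n) (fun n => by rw [hper]) (fun n m hm hm' => ?_)
        hab hbc hca⟩
    rw [det3_neg]
    exact neg_pos.2 (neg_of_mul_pos_right (hall hm hm') h0.le)
  · exact ⟨U, fun n => ⟨_, inv_ne_zero (hφ _), hrep n⟩, fun a b c hab hbc hca =>
      det3_pos_of_edges hper (fun n m hm hm' => (mul_pos_iff_of_pos_left h0).1 (hall hm hm'))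
        hab hbc hca⟩

/-- Adjacent vertices of a convex heptagon, with respect to the hexagon left after deleting one
further vertex. -/
lemma outAll_iff_not_outAll (f : Fin 7 → RP2) (hf : TypicalCfg f) {V : ℕ → Fin 3 → ℝ}
    (hV : ∀ n, ∃ c : ℝ, c ≠ 0 ∧ V n = c • (f (residue7 n)).rep)
    (hpos : ∀ a b c : ℕ, a < b → b < c → c < a + 7 → 0 < det3 (V a) (V b) (V c))
    (i j : Fin 7) {n₀ n₁ n₂ n₃ m : ℕ} (h₀₁ : n₀ < n₁) (h₁₂ : n₁ < n₂) (h₂₃ : n₂ < n₃)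
    (h₃ : n₃ < m) (hm : m + 1 < n₀ + 7) (hi : (residue7 m) = i)
    (hj : ∀ k : Fin 7, k ≠ j ↔ k = residue7 n₀ ∨ k = residue7 n₁ ∨ k = residue7 n₂ ∨ k = residue7 n₃ ∨ k = i ∨ k = i + 1) :
    OutAll f (i + 1) j ↔ ¬ OutAll f i j := by
  have hi' : residue7 (m + 1) = i + 1 := by rw [residue7_succ, hi]
  have hdet := hpos n₀ n₁ n₂ h₀₁ h₁₂ (by omega)
  obtain ⟨b, hb⟩ : ∃ b : Module.Basis (Fin 3) ℝ (Fin 3 → ℝ), ⇑b = ![V n₀, V n₁, V n₂] :=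
    ⟨basisOfLinearIndependentOfCardEqFinrank
      ((linearIndependent_iff_det3_ne_zero _ _ _).2 hdet.ne') (by simp), by simp⟩
  have hb0 : b 0 = V n₀ := by rw [hb]; rfl
  have hb1 : b 1 = V n₁ := by rw [hb]; rfl
  have hb2 : b 2 = V n₂ := by rw [hb]; rfl
  have hq0 (q : QuadraticForm ℝ (Fin 3 → ℝ)) (n : ℕ) : q (V n) = 0 ↔ q (f (residue7 n)).rep = 0 := by
    obtain ⟨c, hc, h⟩ := hV n
    exact q.apply_eq_zero_iff_of_smul hc h
  have hVne (n : ℕ) : V n ≠ 0 := by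
    obtain ⟨c, hc, h⟩ := hV n
    rw [h]
    exact smul_ne_zero hc (rep_nonzero _)
  have hmk (n : ℕ) : Projectivization.mk ℝ (V n) (hVne n) = f (residue7 n) := by
    obtain ⟨c, hc, h⟩ := hV n
    conv_rhs => rw [← (f (residue7 n)).mk_rep]
    rw [Projectivization.mk_eq_mk_iff']
    exact ⟨c, h.symm⟩
  have hbasis (q : QuadraticForm ℝ (Fin 3 → ℝ)) : (∀ k, q (b k) = 0) ↔
      q (f (residue7 n₀)).rep = 0 ∧ q (f (residue7 n₁)).rep = 0 ∧ q (f (residue7 n₂)).rep = 0 := by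
    simp [Fin.forall_fin_succ, hb, hq0]
  have hb' : 0 < det3 (b 0) (b 1) (b 2) := by rwa [hb0, hb1, hb2]
  have hfollow (x : ℕ) (hx : n₃ < x) (hx' : x < n₀ + 7) : FollowsBasis b (V n₃) (V x) := by
    apply followsBasis_of_det3_pos b hb' <;> simp only [hb0, hb1, hb2] <;> apply hpos <;> omega
  obtain ⟨s0, s1, s2⟩ : 0 < b.repr (V n₃) 0 ∧ b.repr (V n₃) 1 < 0 ∧ 0 < b.repr (V n₃) 2 := by
    apply repr_signs b hb' <;> simp only [hb0, hb1, hb2] <;> apply hpos <;> omega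
  have hcon : ∀ q : QuadraticForm ℝ (Fin 3 → ℝ), q ≠ 0 → (∀ k, q (b k) = 0) → q (V n₃) = 0 →
      q (V m) = 0 → q (V (m + 1)) ≠ 0 := by
    intro q hq h1 h2 h3 h4
    rw [hbasis] at h1
    rw [hq0] at h2 h3 h4
    rw [hi] at h3
    rw [hi'] at h4
    refine hf.2 j.succAbove Fin.succAbove_right_injective ⟨q, hq, ?_⟩
    rintro _ ⟨k, rfl⟩
    rcases (hj _).1 (Fin.succAbove_ne j k) with h | h | h | h | h | h <;>
      simp only [Function.comp_apply, h, h1, h2, h3, h4]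
  have key := outFive_iff_not_outFive b s0 s1 s2 (hfollow m h₃ (by omega))
    (hfollow (m + 1) (by omega) hm) (hVne m) (hVne (m + 1)) hcon
  have hout (x y : Fin 7) (w : ℕ) (hw : (residue7 w) = y) (hx : x = i ∧ y = i + 1 ∨ x = i + 1 ∧ y = i) :
      OutFive b (V n₃) (V w) (f x) ↔ OutAll f x j := by
    refine forall_congr' fun q => imp_congr_right fun _ => ?_
    rw [hbasis, hq0, hq0, hw, ← and_imp, ← and_imp]
    refine imp_congr_left ⟨?_, ?_⟩
    · rintro ⟨⟨⟨h1, h2, h3⟩, h4⟩, h5⟩ k hkx hkj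
      rcases (hj k).1 hkj with h | h | h | h | h | h <;> rcases hx with ⟨e, e'⟩ | ⟨e, e'⟩ <;>
        simp_all
    · intro h
      have aux (n : ℕ) (hn : n₀ ≤ n) (hn' : n ≤ n₃) (hnj : (residue7 n) ≠ j) :
          q (f (residue7 n)).rep = 0 := by
        refine h _ ?_ hnj
        rcases hx with ⟨e, -⟩ | ⟨e, -⟩ <;> rw [e]
        · exact hi ▸ residue7_ne (by omega) (by omega)
        · exact hi' ▸ residue7_ne (by omega) (by omega)
      refine ⟨⟨⟨?_, ?_, ?_⟩, ?_⟩, ?_⟩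
      · exact aux _ le_rfl (by omega) ((hj _).2 (by simp))
      · exact aux _ (by omega) (by omega) ((hj _).2 (by simp))
      · exact aux _ (by omega) (by omega) ((hj _).2 (by simp))
      · exact aux _ (by omega) le_rfl ((hj _).2 (by simp))
      · have hii : i ≠ i + 1 := by simp
        refine h y ?_ ((hj y).2 ?_) <;> rcases hx with ⟨e, e'⟩ | ⟨e, e'⟩ <;> rw [e']
        · rw [e]; exact hii.symm
        · rw [e]; exact hii
        all_goals simp
  rw [hmk, hmk, hi, hi', hout (i + 1) i m hi (Or.inr ⟨rfl, rfl⟩),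
    hout i (i + 1) (m + 1) hi' (Or.inl ⟨rfl, rfl⟩)] at key
  exact key

/-- For a heptagonal typical 7-configuration numbered consecutively along the convex
position, `d_{i,j} + d_{i+1,j} = 1` whenever `j ∉ {i, i+1}`. -/
theorem didx_sum_consecutive (f : Fin 7 → RP2)
    (hf : TypicalCfg f) (hconv : ConsecConvexPos f) :
    ∀ i j : Fin 7, j ≠ i → j ≠ i + 1 → dIdx f i j + dIdx f (i + 1) j = 1 := by
  intro i j hji hji'
  obtain ⟨V, hV, hpos⟩ := exists_positive_lift f hf.1 hconv
  have key : OutAll f (i + 1) j ↔ ¬ OutAll f i j := by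
    have main (n₀ n₁ n₂ n₃ : ℕ) := outAll_iff_not_outAll f hf hV hpos i j
      (n₀ := i.val + n₀) (n₁ := i.val + n₁) (n₂ := i.val + n₂) (n₃ := i.val + n₃)
      (m := i.val + 7)
    obtain ⟨d, rfl⟩ : ∃ d, j = i + d := ⟨j - i, by abel⟩
    fin_cases d
    · simp at hji
    · simp at hji'
    · exact main 3 4 5 6 (by omega) (by omega) (by omega) (by omega) (by omega)
        (residue7_val_add_seven i)
        (by clear * -; revert i; decide)
    · exact main 2 4 5 6 (by omega) (by omega) (by omega) (by omega) (by omega)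
        (residue7_val_add_seven i)
        (by clear * -; revert i; decide)
    · exact main 2 3 5 6 (by omega) (by omega) (by omega) (by omega) (by omega)
        (residue7_val_add_seven i)
        (by clear * -; revert i; decide)
    · exact main 2 3 4 6 (by omega) (by omega) (by omega) (by omega) (by omega)
        (residue7_val_add_seven i)
        (by clear * -; revert i; decide)
    · exact main 2 3 4 5 (by omega) (by omega) (by omega) (by omega) (by omega)
        (residue7_val_add_seven i)
        (by clear * -; revert i; decide)
  unfold dIdx
  by_cases h : OutAll f i j
  · rw [if_pos h, if_neg (fun h' => key.1 h' h)]
  · rw [if_neg h, if_pos (key.2 h)]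

end
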